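/- Let A be a finite set such that |A| ≥ 6 and |A| is even. Then the lattice Quo(A) of all quasiorders on A is four-generated: there is a four-element subset of Quo(A) that generates Quo(A). -/

import Mathlib

universe u

open Set

/-- The diagonal (equality) relation on `α`, as a set of pairs. -/
def diagRel (α : Type u) : Set (α × α) := {p | p.1 = p.2}

/-- A quasiorder (preorder): a reflexive and transitive binary relation, as a set of pairs. -/
def IsQuoRel {α : Type u} (r : Set (α × α)) : Prop :=
  (∀ a : α, (a, a) ∈ r) ∧ ∀ a b c : α, (a, b) ∈ r → (b, c) ∈ r → (a, c) ∈ r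

/-- A transitive binary relation, as a set of pairs. -/
def IsTranRel {α : Type u} (r : Set (α × α)) : Prop :=
  ∀ a b c : α, (a, b) ∈ r → (b, c) ∈ r → (a, c) ∈ r

/-- An equivalence relation, as a set of pairs. -/
def IsEquRel {α : Type u} (r : Set (α × α)) : Prop :=
  IsQuoRel r ∧ ∀ p : α × α, p ∈ r → (p.2, p.1) ∈ r

/-- `Quo(α)`: the set of all quasiorders on `α`. -/
def QuoRels (α : Type u) : Set (Set (α × α)) := {r | IsQuoRel r}

/-- `Tran(α)`: the set of all transitive relations on `α`. -/
def TranRels (α : Type u) : Set (Set (α × α)) := {r | IsTranRel r}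

/-- `Equ(α)`: the set of all equivalence relations on `α`. -/
def EquRels (α : Type u) : Set (Set (α × α)) := {r | IsEquRel r}

/-- The least quasiorder containing `r` (the reflexive-transitive closure of `r`). -/
def quoGen {α : Type u} (r : Set (α × α)) : Set (α × α) := ⋂₀ {s | IsQuoRel s ∧ r ⊆ s}

/-- The least transitive relation containing `r` (the transitive closure of `r`). -/
def tranGen {α : Type u} (r : Set (α × α)) : Set (α × α) := ⋂₀ {s | IsTranRel s ∧ r ⊆ s}

/-- The least equivalence relation containing `r`. -/
def equGen {α : Type u} (r : Set (α × α)) : Set (α × α) := ⋂₀ {s | IsEquRel s ∧ r ⊆ s}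

/-- `quo(a,b)`: the least quasiorder containing the pair `(a,b)`. -/
def quoPair {α : Type u} (a b : α) : Set (α × α) := quoGen {(a, b)}

/-- `equ(a,b)`: the least equivalence relation containing the pair `(a,b)`. -/
def equPair {α : Type u} (a b : α) : Set (α × α) := equGen {(a, b)}

/-- The involution: the inverse of a relation. -/
def invRel {α : Type u} (r : Set (α × α)) : Set (α × α) := {p | (p.2, p.1) ∈ r}

/-- `T` is closed under arbitrary (possibly infinite, possibly empty) joins and
meets of the complete lattice `Quo(α)`: the meet of a family of quasiorders is its
intersection and the join is the quasiorder generated by its union. -/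
def QuoClosed {α : Type u} (T : Set (Set (α × α))) : Prop :=
  (∀ S ⊆ T, quoGen (⋃₀ S) ∈ T) ∧ (∀ S ⊆ T, ⋂₀ S ∈ T)

/-- `X` generates the complete lattice `Quo(α)` in the complete sense. -/
def QuoGenerates {α : Type u} (X : Set (Set (α × α))) : Prop :=
  X ⊆ QuoRels α ∧ ∀ T ⊆ QuoRels α, X ⊆ T → QuoClosed T → T = QuoRels α

/-- `T` is closed under arbitrary joins and meets of the complete lattice `Tran(α)`. -/
def TranClosed {α : Type u} (T : Set (Set (α × α))) : Prop :=
  (∀ S ⊆ T, tranGen (⋃₀ S) ∈ T) ∧ (∀ S ⊆ T, ⋂₀ S ∈ T)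

/-- `X` generates the complete lattice `Tran(α)` in the complete sense. -/
def TranGenerates {α : Type u} (X : Set (Set (α × α))) : Prop :=
  X ⊆ TranRels α ∧ ∀ T ⊆ TranRels α, X ⊆ T → TranClosed T → T = TranRels α

/-- `X` generates `Quo(α)` as a complete involution lattice. -/
def QuoInvGenerates {α : Type u} (X : Set (Set (α × α))) : Prop :=
  X ⊆ QuoRels α ∧ ∀ T ⊆ QuoRels α, X ⊆ T → QuoClosed T →
    (∀ r ∈ T, invRel r ∈ T) → T = QuoRels α

/-- `X` generates `Tran(α)` as a complete involution lattice. -/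
def TranInvGenerates {α : Type u} (X : Set (Set (α × α))) : Prop :=
  X ⊆ TranRels α ∧ ∀ T ⊆ TranRels α, X ⊆ T → TranClosed T →
    (∀ r ∈ T, invRel r ∈ T) → T = TranRels α

/-- Incomparability (with respect to inclusion). -/
def Incomp {α : Type u} (a b : Set (α × α)) : Prop := ¬ a ⊆ b ∧ ¬ b ⊆ a

/-- The complete lattice `Quo(α)` is `(1+1+2)`-generated: it is generated, in the
complete sense, by a four-element set `{x₁,x₂,x₃,x₄}` with `x₁ < x₂` such that both
`{x₁,x₃,x₄}` and `{x₂,x₃,x₄}` are antichains. -/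
def QuoOneOneTwoGenerated (α : Type u) : Prop :=
  ∃ x₁ x₂ x₃ x₄ : Set (α × α),
    x₁ ⊂ x₂ ∧ Incomp x₁ x₃ ∧ Incomp x₁ x₄ ∧ Incomp x₂ x₃ ∧ Incomp x₂ x₄ ∧
    Incomp x₃ x₄ ∧ QuoGenerates {x₁, x₂, x₃, x₄}

/-- A cardinal is accessible: it is finite, or it is infinite and every cardinal
`lam ≤ κ` satisfies `lam ≤ 2 ^ μ` for some `μ < lam`, or is at most a sum of fewer
than `lam` many cardinals each smaller than `lam`. -/
def AccessibleCard (κ : Cardinal.{u}) : Prop :=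
  κ < Cardinal.aleph0 ∨
    (Cardinal.aleph0 ≤ κ ∧ ∀ lam : Cardinal.{u}, lam ≤ κ →
      (∃ μ : Cardinal.{u}, μ < lam ∧ lam ≤ 2 ^ μ) ∨
      ∃ (ι : Type u) (f : ι → Cardinal.{u}),
        Cardinal.mk ι < lam ∧ (∀ i : ι, f i < lam) ∧ lam ≤ Cardinal.sum f)
/-- `X` generates the lattice `Quo(α)` (under binary joins and binary meets): the only
subset of `Quo(α)` containing `X` and closed under binary joins and binary meets is
`Quo(α)` itself. -/
def QuoLatGenerates {α : Type u} (X : Set (Set (α × α))) : Prop :=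
  X ⊆ QuoRels α ∧ ∀ T ⊆ QuoRels α, X ⊆ T →
    (∀ a ∈ T, ∀ b ∈ T, quoGen (a ∪ b) ∈ T) →
    (∀ a ∈ T, ∀ b ∈ T, a ∩ b ∈ T) →
    T = QuoRels α
/-- `q` restricts to a quasiorder on `{0, …, N - 1}`. -/
def IsQuoBelow (N : ℕ) (q : ℕ → ℕ → Prop) : Prop :=
  (∀ i < N, q i i) ∧ ∀ i < N, ∀ j < N, ∀ k < N, q i j → q j k → q i k

/-- `P` implies `Q` on `{0, …, N - 1}`. -/
def LeBelow (N : ℕ) (P Q : ℕ → ℕ → Prop) : Prop :=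
  ∀ i < N, ∀ j < N, P i j → Q i j

/-- The join of `P` and `Q` in the lattice of quasiorders on `{0, …, N - 1}`. -/
def joinBelow (N : ℕ) (P Q : ℕ → ℕ → Prop) (i j : ℕ) : Prop :=
  ∀ q, IsQuoBelow N q → LeBelow N P q → LeBelow N Q q → q i j

/-- `M` is a family of relations on `{0, …, N - 1}` closed under meets and under
joins of quasiorders. -/
structure IsSublatticeBelow (N : ℕ) (M : (ℕ → ℕ → Prop) → Prop) : Prop where
  congr : ∀ P Q, LeBelow N P Q → LeBelow N Q P → M P → M Q
  inf : ∀ P Q, M P → M Q → M fun i j => P i j ∧ Q i j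
  sup : ∀ P Q, M P → M Q → M (joinBelow N P Q)

/-- The equivalence whose only possibly nontrivial block is `S`. -/
def blockRel (S : ℕ → Prop) (i j : ℕ) : Prop := i = j ∨ (S i ∧ S j)

/-- The quasiorder generated by the single pair `(x, y)`. -/
def pairRel (x y : ℕ) (i j : ℕ) : Prop := i = j ∨ (i = x ∧ j = y)

/-- Equality of parity on `{0, …, 2n}`, the point `2n + 1` being isolated. -/
def parityRel (n : ℕ) (i j : ℕ) : Prop := i = j ∨ (i % 2 = j % 2 ∧ i ≤ 2 * n ∧ j ≤ 2 * n)

/-- The perfect matching `{0,1}, {2,3}, …, {2n,2n+1}` of the cycle `0, …, 2n+1`. -/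
def evenMatching (i j : ℕ) : Prop := i / 2 = j / 2

/-- The perfect matching `{1,2}, {3,4}, …, {2n+1,0}` of the cycle `0, …, 2n+1`. -/
def oddMatching (n : ℕ) (i j : ℕ) : Prop :=
  (i + 1) / 2 = (j + 1) / 2 ∨ (i = 0 ∧ j = 2 * n + 1) ∨ (j = 0 ∧ i = 2 * n + 1)

/-- The quasiorder with blocks `{0,1}` and `{2n-1,2n}` and the one-way pair `(2n+1,2)`. -/
def endsRel (n : ℕ) (i j : ℕ) : Prop :=
  i = j ∨ (i ≤ 1 ∧ j ≤ 1) ∨ (2 * n - 1 ≤ i ∧ i ≤ 2 * n ∧ 2 * n - 1 ≤ j ∧ j ≤ 2 * n) ∨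
    (i = 2 * n + 1 ∧ j = 2)

/-- Equality of parity on `{0, …, k}`. -/
def lowerParity (k : ℕ) (i j : ℕ) : Prop := i = j ∨ (i % 2 = j % 2 ∧ i ≤ k ∧ j ≤ k)

/-- Equality of parity on `{k, …, 2n}`. -/
def upperParity (n k : ℕ) (i j : ℕ) : Prop :=
  i = j ∨ (i % 2 = j % 2 ∧ k ≤ i ∧ k ≤ j ∧ i ≤ 2 * n ∧ j ≤ 2 * n)

namespace IsSublatticeBelow

variable {N n : ℕ} {M : (ℕ → ℕ → Prop) → Prop}

/-- To show that `W = (P ∨ Q) ∧ R`, it suffices to bound `P ∨ Q` by a quasiorder `U`. -/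
theorem join_meet (hM : IsSublatticeBelow N M) {P Q R W : ℕ → ℕ → Prop} (U : ℕ → ℕ → Prop)
    (hP : M P) (hQ : M Q) (hR : M R) (hU : IsQuoBelow N U) (hPU : LeBelow N P U)
    (hQU : LeBelow N Q U) (hUW : LeBelow N (fun i j => U i j ∧ R i j) W) (hWR : LeBelow N W R)
    (hW : ∀ q, IsQuoBelow N q → LeBelow N P q → LeBelow N Q q → LeBelow N W q) : M W :=
  hM.congr _ _
    (fun i hi j hj h => hUW i hi j hj ⟨h.1 U hU hPU hQU, h.2⟩)
    (fun i hi j hj h => ⟨fun q hq h1 h2 => hW q hq h1 h2 i hi j hj h, hWR i hi j hj h⟩)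
    (hM.inf _ _ (hM.sup _ _ hP hQ) hR)

theorem join (hM : IsSublatticeBelow N M) {P Q W : ℕ → ℕ → Prop}
    (hP : M P) (hQ : M Q) (hU : IsQuoBelow N W) (hPU : LeBelow N P W)
    (hQU : LeBelow N Q W)
    (hW : ∀ q, IsQuoBelow N q → LeBelow N P q → LeBelow N Q q → LeBelow N W q) : M W :=
  hM.congr _ _ (fun _ _ _ _ h => h W hU hPU hQU)
    (fun i hi j hj h q hq h1 h2 => hW q hq h1 h2 i hi j hj h) (hM.sup _ _ hP hQ)

theorem meet (hM : IsSublatticeBelow N M) {P Q W : ℕ → ℕ → Prop} (hP : M P) (hQ : M Q)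
    (h : ∀ i < N, ∀ j < N, W i j ↔ P i j ∧ Q i j) : M W :=
  hM.congr _ _ (fun i hi j hj => (h i hi j hj).2) (fun i hi j hj => (h i hi j hj).1)
    (hM.inf _ _ hP hQ)

theorem lowerParity_two (hM : IsSublatticeBelow (2 * n + 2) M) (hn : 2 ≤ n)
    (hα : M (parityRel n)) (hγ : M (oddMatching n)) (h0 : M (blockRel fun i => i ≤ 1)) :
    M (lowerParity 2) := by
  refine hM.join_meet
    (fun i j => (i ≤ 2 ∨ i = 2 * n + 1) ∧ (j ≤ 2 ∨ j = 2 * n + 1) ∨ oddMatching n i j)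
    h0 hγ hα ?_ ?_ ?_ ?_ ?_ ?_
  · constructor
    · simp [oddMatching]
    · simp only [oddMatching]; omega
  · simp only [LeBelow, blockRel, oddMatching]; omega
  · simp only [LeBelow, oddMatching]; omega
  · simp only [LeBelow, oddMatching, parityRel, lowerParity]; omega
  · simp only [LeBelow, parityRel, lowerParity]; omega
  · intro q ⟨hr, ht⟩ h1 h2 i hi j hj h
    simp only [LeBelow, blockRel, oddMatching, lowerParity] at h1 h2 h
    have h02 : q 0 2 := ht 0 (by omega) 1 (by omega) 2 (by omega)
      (h1 _ (by omega) _ (by omega) (by omega)) (h2 _ (by omega) _ (by omega) (by omega))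
    have h20 : q 2 0 := ht 2 (by omega) 1 (by omega) 0 (by omega)
      (h2 _ (by omega) _ (by omega) (by omega)) (h1 _ (by omega) _ (by omega) (by omega))
    by_cases hij : i = j
    · exact hij ▸ hr i hi
    · obtain ⟨rfl, rfl⟩ | ⟨rfl, rfl⟩ : i = 0 ∧ j = 2 ∨ i = 2 ∧ j = 0 := by omega
      · exact h02
      · exact h20

theorem lowerParity_succ_of_even (hM : IsSublatticeBelow (2 * n + 2) M)
    (hα : M (parityRel n)) (hβ : M evenMatching) {k : ℕ} (hk : k % 2 = 0) (hkn : k < 2 * n)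
    (h : M (lowerParity k)) : M (lowerParity (k + 1)) := by
  refine hM.join_meet (fun i j => (i ≤ k + 1 ∧ j ≤ k + 1) ∨ evenMatching i j)
    h hβ hα ?_ ?_ ?_ ?_ ?_ ?_
  · constructor
    · simp [evenMatching]
    · simp only [evenMatching]; omega
  · simp only [LeBelow, lowerParity, evenMatching]; omega
  · simp only [LeBelow, evenMatching]; omega
  · simp only [LeBelow, evenMatching, parityRel, lowerParity]; omega
  · simp only [LeBelow, parityRel, lowerParity]; omega
  · intro q ⟨hr, ht⟩ h1 h2 i hi j hj h
    simp only [LeBelow, evenMatching, lowerParity] at h1 h2 h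
    by_cases hij : i = j
    · exact hij ▸ hr i hi
    by_cases hi2 : i % 2 = 0
    · exact h1 i hi j hj (by omega)
    · exact ht i hi (i - 1) (by omega) j hj (h2 _ (by omega) _ (by omega) (by omega)) <|
        ht (i - 1) (by omega) (j - 1) (by omega) j hj
          (h1 _ (by omega) _ (by omega) (by omega)) (h2 _ (by omega) _ (by omega) (by omega))

theorem lowerParity_succ_of_odd (hM : IsSublatticeBelow (2 * n + 2) M)
    (hα : M (parityRel n)) (hγ : M (oddMatching n)) {k : ℕ} (hk : k % 2 = 1) (hk2 : 2 ≤ k)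
    (hkn : k < 2 * n) (h : M (lowerParity k)) : M (lowerParity (k + 1)) := by
  refine hM.join_meet
    (fun i j => (i ≤ k + 1 ∨ i = 2 * n + 1) ∧ (j ≤ k + 1 ∨ j = 2 * n + 1) ∨ oddMatching n i j)
    h hγ hα ?_ ?_ ?_ ?_ ?_ ?_
  · constructor
    · simp [oddMatching]
    · simp only [oddMatching]; omega
  · simp only [LeBelow, lowerParity, oddMatching]; omega
  · simp only [LeBelow, oddMatching]; omega
  · simp only [LeBelow, oddMatching, parityRel, lowerParity]; omega
  · simp only [LeBelow, parityRel, lowerParity]; omega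
  · intro q ⟨hr, ht⟩ h1 h2 i hi j hj h
    simp only [LeBelow, oddMatching, lowerParity] at h1 h2 h
    by_cases hij : i = j
    · exact hij ▸ hr i hi
    by_cases hi2 : i % 2 = 1
    · exact h1 i hi j hj (by omega)
    · have down : ∀ i ≤ k + 1, i % 2 = 0 → q i 1 := fun i hik hi => by
        by_cases hi0 : i = 0
        · exact ht i (by omega) 2 (by omega) 1 (by omega)
            (h1 _ (by omega) _ (by omega) (by omega)) (h2 _ (by omega) _ (by omega) (by omega))
        · exact ht i (by omega) (i - 1) (by omega) 1 (by omega)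
            (h2 _ (by omega) _ (by omega) (by omega)) (h1 _ (by omega) _ (by omega) (by omega))
      have up : ∀ i ≤ k + 1, i % 2 = 0 → q 1 i := fun i hik hi => by
        by_cases hi0 : i = 0
        · exact ht 1 (by omega) 2 (by omega) i (by omega)
            (h2 _ (by omega) _ (by omega) (by omega)) (h1 _ (by omega) _ (by omega) (by omega))
        · exact ht 1 (by omega) (i - 1) (by omega) i (by omega)
            (h1 _ (by omega) _ (by omega) (by omega)) (h2 _ (by omega) _ (by omega) (by omega))
      exact ht i hi 1 (by omega) j hj (down i (by omega) (by omega)) (up j (by omega) (by omega))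

theorem lowerParity_mem (hM : IsSublatticeBelow (2 * n + 2) M) (hn : 2 ≤ n)
    (hα : M (parityRel n)) (hβ : M evenMatching) (hγ : M (oddMatching n))
    (h0 : M (blockRel fun i => i ≤ 1)) {k : ℕ} (hk : 2 ≤ k) (hkn : k ≤ 2 * n) :
    M (lowerParity k) := by
  induction k, hk using Nat.le_induction with
  | base => exact hM.lowerParity_two hn hα hγ h0
  | succ k hk ih =>
    obtain h | h := Nat.mod_two_eq_zero_or_one k
    · exact hM.lowerParity_succ_of_even hα hβ h (by omega) (ih (by omega))
    · exact hM.lowerParity_succ_of_odd hα hγ h hk (by omega) (ih (by omega))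

theorem upperParity_top (hM : IsSublatticeBelow (2 * n + 2) M) (hn : 2 ≤ n)
    (hα : M (parityRel n)) (hβ : M evenMatching)
    (h0 : M (blockRel fun i => 2 * n - 1 ≤ i ∧ i ≤ 2 * n)) :
    M (upperParity n (2 * n - 2)) := by
  refine hM.join_meet (fun i j => (2 * n - 2 ≤ i ∧ 2 * n - 2 ≤ j) ∨ evenMatching i j)
    h0 hβ hα ?_ ?_ ?_ ?_ ?_ ?_
  · constructor
    · simp [evenMatching]
    · simp only [evenMatching]; omega
  · simp only [LeBelow, blockRel, evenMatching]; omega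
  · simp only [LeBelow, evenMatching]; omega
  · simp only [LeBelow, evenMatching, parityRel, upperParity]; omega
  · simp only [LeBelow, parityRel, upperParity]; omega
  · intro q ⟨hr, ht⟩ h1 h2 i hi j hj h
    simp only [LeBelow, blockRel, evenMatching, upperParity] at h1 h2 h
    by_cases hij : i = j
    · exact hij ▸ hr i hi
    refine ht i hi (2 * n - 1) (by omega) j hj ?_ ?_
    · obtain h | h : i = 2 * n ∨ i = 2 * n - 2 := by omega
      · exact h1 _ (by omega) _ (by omega) (by omega)
      · exact h2 _ (by omega) _ (by omega) (by omega)
    · obtain h | h : j = 2 * n ∨ j = 2 * n - 2 := by omega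
      · exact h1 _ (by omega) _ (by omega) (by omega)
      · exact h2 _ (by omega) _ (by omega) (by omega)

theorem upperParity_of_succ_even (hM : IsSublatticeBelow (2 * n + 2) M)
    (hα : M (parityRel n)) (hγ : M (oddMatching n)) {k : ℕ} (hk : k % 2 = 1) (hkn : k < 2 * n)
    (h : M (upperParity n (k + 1))) : M (upperParity n k) := by
  refine hM.join_meet
    (fun i j => (k ≤ i ∧ i ≤ 2 * n ∧ k ≤ j ∧ j ≤ 2 * n) ∨ oddMatching n i j)
    h hγ hα ?_ ?_ ?_ ?_ ?_ ?_
  · constructor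
    · simp [oddMatching]
    · simp only [oddMatching]; omega
  · simp only [LeBelow, upperParity, oddMatching]; omega
  · simp only [LeBelow, oddMatching]; omega
  · simp only [LeBelow, oddMatching, parityRel, upperParity]; omega
  · simp only [LeBelow, parityRel, upperParity]; omega
  · intro q ⟨hr, ht⟩ h1 h2 i hi j hj h
    simp only [LeBelow, oddMatching, upperParity] at h1 h2 h
    by_cases hij : i = j
    · exact hij ▸ hr i hi
    by_cases hi2 : i % 2 = 0
    · exact h1 i hi j hj (by omega)
    · exact ht i hi (i + 1) (by omega) j hj (h2 _ (by omega) _ (by omega) (by omega)) <|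
        ht (i + 1) (by omega) (j + 1) (by omega) j hj
          (h1 _ (by omega) _ (by omega) (by omega)) (h2 _ (by omega) _ (by omega) (by omega))

theorem upperParity_of_succ_odd (hM : IsSublatticeBelow (2 * n + 2) M)
    (hα : M (parityRel n)) (hβ : M evenMatching) {k : ℕ} (hk : k % 2 = 0) (hkn : k + 3 < 2 * n + 1)
    (h : M (upperParity n (k + 1))) : M (upperParity n k) := by
  refine hM.join_meet (fun i j => (k ≤ i ∧ k ≤ j) ∨ evenMatching i j)
    h hβ hα ?_ ?_ ?_ ?_ ?_ ?_
  · constructor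
    · simp [evenMatching]
    · simp only [evenMatching]; omega
  · simp only [LeBelow, upperParity, evenMatching]; omega
  · simp only [LeBelow, evenMatching]; omega
  · simp only [LeBelow, evenMatching, parityRel, upperParity]; omega
  · simp only [LeBelow, parityRel, upperParity]; omega
  · intro q ⟨hr, ht⟩ h1 h2 i hi j hj h
    simp only [LeBelow, evenMatching, upperParity] at h1 h2 h
    by_cases hij : i = j
    · exact hij ▸ hr i hi
    by_cases hi2 : i % 2 = 1
    · exact h1 i hi j hj (by omega)
    · have up : ∀ i, k ≤ i → i ≤ 2 * n → i % 2 = 0 → q i (2 * n - 1) := fun i hik hin hi => by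
        by_cases hi0 : i = 2 * n
        · exact ht i (by omega) (2 * n - 2) (by omega) _ (by omega)
            (h1 _ (by omega) _ (by omega) (by omega)) (h2 _ (by omega) _ (by omega) (by omega))
        · exact ht i (by omega) (i + 1) (by omega) _ (by omega)
            (h2 _ (by omega) _ (by omega) (by omega)) (h1 _ (by omega) _ (by omega) (by omega))
      have down : ∀ i, k ≤ i → i ≤ 2 * n → i % 2 = 0 → q (2 * n - 1) i := fun i hik hin hi => by
        by_cases hi0 : i = 2 * n
        · exact ht _ (by omega) (2 * n - 2) (by omega) i (by omega)
            (h2 _ (by omega) _ (by omega) (by omega)) (h1 _ (by omega) _ (by omega) (by omega))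
        · exact ht _ (by omega) (i + 1) (by omega) i (by omega)
            (h1 _ (by omega) _ (by omega) (by omega)) (h2 _ (by omega) _ (by omega) (by omega))
      exact ht i hi (2 * n - 1) (by omega) j hj (up i (by omega) (by omega) (by omega))
        (down j (by omega) (by omega) (by omega))

theorem upperParity_mem (hM : IsSublatticeBelow (2 * n + 2) M) (hn : 2 ≤ n)
    (hα : M (parityRel n)) (hβ : M evenMatching) (hγ : M (oddMatching n))
    (h0 : M (blockRel fun i => 2 * n - 1 ≤ i ∧ i ≤ 2 * n)) {k : ℕ} (hkn : k ≤ 2 * n - 2) :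
    M (upperParity n k) := by
  induction hkn using Nat.decreasingInduction with
  | self => exact hM.upperParity_top hn hα hβ h0
  | of_succ k hk ih =>
    obtain h | h := Nat.mod_two_eq_zero_or_one k
    · exact hM.upperParity_of_succ_odd hα hβ h (by omega) ih
    · exact hM.upperParity_of_succ_even hα hγ h (by omega) ih

theorem block_succ_of_odd (hM : IsSublatticeBelow (2 * n + 2) M)
    (hβ : M evenMatching) (hγ : M (oddMatching n)) {k : ℕ} (hk : k % 2 = 1) (hkn : k + 2 < 2 * n)
    (hL : M (lowerParity (k + 1))) (hR : M (upperParity n k)) :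
    M (blockRel fun i => k ≤ i ∧ i ≤ k + 1) := by
  have h1 : M fun i j => oddMatching n i j ∧ (i = j ∨ i ≤ k + 1 ∧ j ≤ k + 1) := by
    refine hM.join_meet (fun i j => (i ≤ k + 2 ∧ j ≤ k + 2) ∨ evenMatching i j)
      hL hβ hγ ?_ ?_ ?_ ?_ ?_ ?_
    · constructor
      · simp [evenMatching]
      · simp only [evenMatching]; omega
    · simp only [LeBelow, lowerParity, evenMatching]; omega
    · simp only [LeBelow, evenMatching]; omega
    · simp only [LeBelow, evenMatching, oddMatching]; omega
    · simp only [LeBelow, oddMatching]; omega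
    · intro q ⟨hr, ht⟩ h1 h2 i hi j hj h
      simp only [LeBelow, evenMatching, oddMatching, lowerParity] at h1 h2 h
      by_cases hij : i = j
      · exact hij ▸ hr i hi
      obtain ⟨rfl, hi2⟩ | ⟨rfl, hj2⟩ : j = i + 1 ∧ i % 2 = 1 ∨ i = j + 1 ∧ j % 2 = 1 := by omega
      · exact ht _ hi (i - 1) (by omega) _ hj (h2 _ (by omega) _ (by omega) (by omega))
          (h1 _ (by omega) _ (by omega) (by omega))
      · exact ht _ hi (j - 1) (by omega) _ hj (h1 _ (by omega) _ (by omega) (by omega))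
          (h2 _ (by omega) _ (by omega) (by omega))
  refine hM.join_meet (fun i j => (k - 1 ≤ i ∧ k - 1 ≤ j) ∨ evenMatching i j)
    hR hβ h1 ?_ ?_ ?_ ?_ ?_ ?_
  · constructor
    · simp [evenMatching]
    · simp only [evenMatching]; omega
  · simp only [LeBelow, upperParity, evenMatching]; omega
  · simp only [LeBelow, evenMatching]; omega
  · simp only [LeBelow, evenMatching, oddMatching, blockRel]; omega
  · simp only [LeBelow, oddMatching, blockRel]; omega
  · intro q ⟨hr, ht⟩ h1 h2 i hi j hj h
    simp only [LeBelow, evenMatching, upperParity, blockRel] at h1 h2 h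
    by_cases hij : i = j
    · exact hij ▸ hr i hi
    obtain ⟨rfl, rfl⟩ | ⟨rfl, rfl⟩ : i = k ∧ j = k + 1 ∨ i = k + 1 ∧ j = k := by omega
    · exact ht _ hi (i + 2) (by omega) _ hj (h1 _ (by omega) _ (by omega) (by omega))
        (h2 _ (by omega) _ (by omega) (by omega))
    · exact ht _ hi (j + 2) (by omega) _ hj (h2 _ (by omega) _ (by omega) (by omega))
        (h1 _ (by omega) _ (by omega) (by omega))

theorem block_succ_of_even (hM : IsSublatticeBelow (2 * n + 2) M)
    (hβ : M evenMatching) (hγ : M (oddMatching n)) {k : ℕ} (hk : k % 2 = 0) (hk0 : 0 < k)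
    (hkn : k + 1 < 2 * n) (hL : M (lowerParity (k + 1))) (hR : M (upperParity n k)) :
    M (blockRel fun i => k ≤ i ∧ i ≤ k + 1) := by
  have h1 : M fun i j => evenMatching i j ∧
      (i = j ∨ k ≤ i ∧ k ≤ j ∧ i ≤ 2 * n - 1 ∧ j ≤ 2 * n - 1) := by
    refine hM.join_meet
      (fun i j => (k - 1 ≤ i ∧ i ≤ 2 * n ∧ k - 1 ≤ j ∧ j ≤ 2 * n) ∨ oddMatching n i j)
      hR hγ hβ ?_ ?_ ?_ ?_ ?_ ?_
    · constructor
      · simp [oddMatching]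
      · simp only [oddMatching]; omega
    · simp only [LeBelow, upperParity, oddMatching]; omega
    · simp only [LeBelow, oddMatching]; omega
    · simp only [LeBelow, evenMatching, oddMatching]; omega
    · simp only [LeBelow, evenMatching]; omega
    · intro q ⟨hr, ht⟩ h1 h2 i hi j hj h
      simp only [LeBelow, evenMatching, oddMatching, upperParity] at h1 h2 h
      by_cases hij : i = j
      · exact hij ▸ hr i hi
      obtain ⟨rfl, hi2⟩ | ⟨rfl, hj2⟩ : j = i + 1 ∧ i % 2 = 0 ∨ i = j + 1 ∧ j % 2 = 0 := by omega
      · exact ht _ hi (i + 2) (by omega) _ hj (h1 _ (by omega) _ (by omega) (by omega))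
          (h2 _ (by omega) _ (by omega) (by omega))
      · exact ht _ hi (j + 2) (by omega) _ hj (h2 _ (by omega) _ (by omega) (by omega))
          (h1 _ (by omega) _ (by omega) (by omega))
  refine hM.join_meet
    (fun i j => (i ≤ k + 2 ∨ i = 2 * n + 1) ∧ (j ≤ k + 2 ∨ j = 2 * n + 1) ∨ oddMatching n i j)
    hL hγ h1 ?_ ?_ ?_ ?_ ?_ ?_
  · constructor
    · simp [oddMatching]
    · simp only [oddMatching]; omega
  · simp only [LeBelow, lowerParity, oddMatching]; omega
  · simp only [LeBelow, oddMatching]; omega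
  · simp only [LeBelow, evenMatching, oddMatching, blockRel]; omega
  · simp only [LeBelow, evenMatching, blockRel]; omega
  · intro q ⟨hr, ht⟩ h1 h2 i hi j hj h
    simp only [LeBelow, oddMatching, lowerParity, blockRel] at h1 h2 h
    by_cases hij : i = j
    · exact hij ▸ hr i hi
    obtain ⟨rfl, rfl⟩ | ⟨rfl, rfl⟩ : i = k ∧ j = k + 1 ∨ i = k + 1 ∧ j = k := by omega
    · exact ht _ hi (i - 1) (by omega) _ hj (h2 _ (by omega) _ (by omega) (by omega))
        (h1 _ (by omega) _ (by omega) (by omega))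
    · exact ht _ hi (j - 1) (by omega) _ hj (h1 _ (by omega) _ (by omega) (by omega))
        (h2 _ (by omega) _ (by omega) (by omega))

theorem block_congr (hM : IsSublatticeBelow N M) {S S' : ℕ → Prop}
    (hS : M (blockRel S)) (h : ∀ i < N, S i ↔ S' i) : M (blockRel S') := by
  refine hM.congr _ _ ?_ ?_ hS <;> intro i hi j hj <;> simp only [blockRel, h i hi, h j hj] <;>
    exact id

theorem block_inter (hM : IsSublatticeBelow N M) {S S' : ℕ → Prop}
    (hS : M (blockRel S)) (hS' : M (blockRel S')) : M (blockRel fun i => S i ∧ S' i) :=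
  hM.meet hS hS' fun i _ j _ => by simp only [blockRel]; tauto

theorem block_union (hM : IsSublatticeBelow N M) {S S' : ℕ → Prop}
    (hS : M (blockRel S)) (hS' : M (blockRel S')) (x : ℕ) (hx : x < N) (hxS : S x)
    (hxS' : S' x) : M (blockRel fun i => S i ∨ S' i) := by
  refine hM.join hS hS' ?_ ?_ ?_ ?_
  · constructor
    · exact fun i _ => Or.inl rfl
    · rintro i - j - k - (rfl | h) (rfl | h') <;> simp only [blockRel] <;> tauto
  · rintro i - j - (h | h) <;> simp only [blockRel] <;> tauto
  · rintro i - j - (h | h) <;> simp only [blockRel] <;> tauto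
  · rintro q ⟨hr, ht⟩ h1 h2 i hi j hj (rfl | h)
    · exact hr i hi
    · refine ht i hi x hx j hj ?_ ?_
      · exact h.1.elim (fun h => h1 _ hi _ hx (Or.inr ⟨h, hxS⟩))
          (fun h => h2 _ hi _ hx (Or.inr ⟨h, hxS'⟩))
      · exact h.2.elim (fun h => h1 _ hx _ hj (Or.inr ⟨hxS, h⟩))
          (fun h => h2 _ hx _ hj (Or.inr ⟨hxS', h⟩))

theorem block_interval (hM : IsSublatticeBelow N M) (h0 : M Eq) {m : ℕ} (hm : m < N)
    (h : ∀ k < m, M (blockRel fun i => k ≤ i ∧ i ≤ k + 1)) {i j : ℕ} (hij : i ≤ j) (hj : j ≤ m) :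
    M (blockRel fun x => i ≤ x ∧ x ≤ j) := by
  induction j, hij using Nat.le_induction with
  | base =>
    exact hM.congr _ _ (fun _ _ _ _ h => Or.inl h) (fun x _ y _ h => by
      simp only [blockRel] at h; omega) h0
  | succ j hij ih =>
    exact hM.block_congr
      (hM.block_union (ih (by omega)) (h j (by omega)) j (by omega) (by omega) (by omega))
      (fun x _ => by omega)

/-- If the blocks `{k, k + 2}` with `k ≡ r (mod 2)` belong to `M`, so do the blocks formed by
all numbers of that parity in an initial segment. -/
theorem block_parity (hM : IsSublatticeBelow N M) (h0 : M Eq) {r m : ℕ} (hm : r + 2 * m < N)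
    (h : ∀ k, k + 2 ≤ r + 2 * m → M (blockRel fun i => i = k ∨ i = k + 2)) :
    M (blockRel fun i => ∃ t ≤ m, i = r + 2 * t) := by
  induction m with
  | zero =>
    exact hM.congr _ _ (fun _ _ _ _ h => Or.inl h) (fun x _ y _ h => by
      obtain h | ⟨⟨t, ht, hx⟩, ⟨s, hs, hy⟩⟩ := h
      · exact h
      · omega) h0
  | succ m ih =>
    refine hM.block_congr
      (hM.block_union (ih (by omega) fun k hk => h k (by omega)) (h (r + 2 * m) (by omega))
        (r + 2 * m) (by omega) ⟨m, le_rfl, rfl⟩ (by omega)) (fun x _ => ⟨?_, ?_⟩)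
    · rintro (⟨t, ht, rfl⟩ | rfl | rfl)
      · exact ⟨t, by omega, rfl⟩
      · exact ⟨m, by omega, rfl⟩
      · exact ⟨m + 1, by omega, by omega⟩
    · rintro ⟨t, ht, rfl⟩
      obtain rfl | ht := Nat.eq_or_lt_of_le ht
      · exact Or.inr (by omega)
      · exact Or.inl ⟨t, by omega, rfl⟩

theorem block_ends (hM : IsSublatticeBelow (2 * n + 2) M) (hn : 2 ≤ n) (h0 : M Eq)
    (hα : M (parityRel n)) (h : ∀ k < 2 * n, M (blockRel fun i => k ≤ i ∧ i ≤ k + 1)) :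
    M (blockRel fun i => i = 0 ∨ i = 2 * n) := by
  have h2 : ∀ k, k + 2 ≤ 2 * n → M (blockRel fun i => i = k ∨ i = k + 2) := fun k hk =>
    hM.meet hα (hM.block_interval h0 (m := 2 * n) (by omega) h (i := k) (j := k + 2) (by omega) hk)
      fun i _ j _ => by simp only [blockRel, parityRel]; omega
  have hev := hM.block_parity h0 (r := 0) (m := n) (by omega) fun k hk => h2 k (by omega)
  have hod := hM.block_parity h0 (r := 1) (m := n - 1) (by omega) fun k hk => h2 k (by omega)
  have hpath := hM.block_union
    (hM.block_union (h 0 (by omega)) hod 1 (by omega) (by omega) ⟨0, by omega, rfl⟩)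
    (h (2 * n - 1) (by omega)) (2 * n - 1) (by omega) (Or.inr ⟨n - 1, le_rfl, by omega⟩) (by omega)
  refine hM.block_congr (hM.block_inter hev hpath) fun i _ => ⟨?_, ?_⟩
  · rintro ⟨⟨t, _, rfl⟩, (_ | ⟨s, _, _⟩) | _⟩ <;> omega
  · rintro (rfl | rfl)
    · exact ⟨⟨0, by omega, rfl⟩, Or.inl (Or.inl (by omega))⟩
    · exact ⟨⟨n, le_rfl, by omega⟩, Or.inr (by omega)⟩

theorem block_zero_last (hM : IsSublatticeBelow (2 * n + 2) M) (hn : 2 ≤ n)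
    (hβ : M evenMatching) (hγ : M (oddMatching n)) (h : M (blockRel fun i => i = 0 ∨ i = 2 * n)) :
    M (blockRel fun i => i = 0 ∨ i = 2 * n + 1) := by
  refine hM.join_meet (fun i j => ((i ≤ 1 ∨ 2 * n ≤ i) ∧ (j ≤ 1 ∨ 2 * n ≤ j)) ∨ evenMatching i j)
    h hβ hγ ?_ ?_ ?_ ?_ ?_ ?_
  · constructor
    · simp [evenMatching]
    · simp only [evenMatching]; omega
  · simp only [LeBelow, blockRel, evenMatching]; omega
  · simp only [LeBelow, evenMatching]; omega
  · simp only [LeBelow, evenMatching, oddMatching, blockRel]; omega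
  · simp only [LeBelow, oddMatching, blockRel]; omega
  · intro q ⟨hr, ht⟩ h1 h2 i hi j hj h
    simp only [LeBelow, evenMatching, blockRel] at h1 h2 h
    by_cases hij : i = j
    · exact hij ▸ hr i hi
    obtain ⟨rfl, rfl⟩ | ⟨rfl, rfl⟩ : i = 0 ∧ j = 2 * n + 1 ∨ i = 2 * n + 1 ∧ j = 0 := by omega
    · exact ht _ hi (2 * n) (by omega) _ hj (h1 _ (by omega) _ (by omega) (by omega))
        (h2 _ (by omega) _ (by omega) (by omega))
    · exact ht _ hi (2 * n) (by omega) _ hj (h2 _ (by omega) _ (by omega) (by omega))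
        (h1 _ (by omega) _ (by omega) (by omega))

theorem block_last_two (hM : IsSublatticeBelow (2 * n + 2) M) (hn : 2 ≤ n)
    (hβ : M evenMatching) (hγ : M (oddMatching n)) (h : M (blockRel fun i => i = 0 ∨ i = 2 * n)) :
    M (blockRel fun i => 2 * n ≤ i ∧ i ≤ 2 * n + 1) := by
  refine hM.join_meet
    (fun i j => ((i = 0 ∨ 2 * n - 1 ≤ i) ∧ (j = 0 ∨ 2 * n - 1 ≤ j)) ∨ oddMatching n i j)
    h hγ hβ ?_ ?_ ?_ ?_ ?_ ?_
  · constructor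
    · simp [oddMatching]
    · simp only [oddMatching]; omega
  · simp only [LeBelow, blockRel, oddMatching]; omega
  · simp only [LeBelow, oddMatching]; omega
  · simp only [LeBelow, evenMatching, oddMatching, blockRel]; omega
  · simp only [LeBelow, evenMatching, blockRel]; omega
  · intro q ⟨hr, ht⟩ h1 h2 i hi j hj h
    simp only [LeBelow, oddMatching, blockRel] at h1 h2 h
    by_cases hij : i = j
    · exact hij ▸ hr i hi
    obtain ⟨rfl, rfl⟩ | ⟨rfl, rfl⟩ :
      i = 2 * n ∧ j = 2 * n + 1 ∨ i = 2 * n + 1 ∧ j = 2 * n := by omega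
    · exact ht _ hi 0 (by omega) _ hj (h1 _ (by omega) _ (by omega) (by omega))
        (h2 _ (by omega) _ (by omega) (by omega))
    · exact ht _ hi 0 (by omega) _ hj (h2 _ (by omega) _ (by omega) (by omega))
        (h1 _ (by omega) _ (by omega) (by omega))

/-- The circle principle: if the edges of a cycle through all points belong to `M`, then so do
all two-element blocks. -/
theorem block_pair_of_cycle (hM : IsSublatticeBelow (N + 1) M) (h0 : M Eq)
    (h : ∀ k < N, M (blockRel fun i => k ≤ i ∧ i ≤ k + 1))
    (hlast : M (blockRel fun i => i = 0 ∨ i = N)) {x y : ℕ} (hxy : x < y) (hy : y ≤ N) :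
    M (blockRel fun i => i = x ∨ i = y) := by
  have hI {i j : ℕ} (hij : i ≤ j) (hj : j ≤ N) : M (blockRel fun x => i ≤ x ∧ x ≤ j) :=
    hM.block_interval h0 (Nat.lt_succ_self N) h hij hj
  have hO := hM.block_union
    (hM.block_union (hI (Nat.zero_le x) (by omega)) hlast 0 (by omega) (by omega) (by omega))
    (hI hy le_rfl) N (by omega) (by omega) (by omega)
  exact hM.block_congr (hM.block_inter (hI hxy.le hy) hO) fun i _ => by omega

theorem block_pair_mem (hM : IsSublatticeBelow (2 * n + 2) M) (hn : 2 ≤ n)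
    (hα : M (parityRel n)) (hβ : M evenMatching) (hγ : M (oddMatching n)) (hδ : M (endsRel n))
    {x y : ℕ} (hx : x < 2 * n + 2) (hy : y < 2 * n + 2) (hxy : x ≠ y) :
    M (blockRel fun i => i = x ∨ i = y) := by
  have hfirst : M (blockRel fun i => i ≤ 1) :=
    hM.meet hβ hδ fun i _ j _ => by simp only [blockRel, evenMatching, endsRel]; omega
  have hlast : M (blockRel fun i => 2 * n - 1 ≤ i ∧ i ≤ 2 * n) :=
    hM.meet hγ hδ fun i _ j _ => by simp only [blockRel, oddMatching, endsRel]; omega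
  have h0 : M Eq := hM.meet hα hβ fun i _ j _ => by simp only [parityRel, evenMatching]; omega
  have hedge : ∀ k < 2 * n, M (blockRel fun i => k ≤ i ∧ i ≤ k + 1) := fun k hk => by
    by_cases hk0 : k = 0
    · exact hM.block_congr hfirst fun i _ => by omega
    by_cases hk1 : k = 2 * n - 1
    · exact hM.block_congr hlast fun i _ => by omega
    have hL := hM.lowerParity_mem hn hα hβ hγ hfirst (k := k + 1) (by omega) (by omega)
    have hR := hM.upperParity_mem hn hα hβ hγ hlast (k := k) (by omega)
    obtain h | h := Nat.mod_two_eq_zero_or_one k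
    · exact hM.block_succ_of_even hβ hγ h (by omega) (by omega) hL hR
    · exact hM.block_succ_of_odd hβ hγ h (by omega) hL hR
  have hends := hM.block_ends hn h0 hα hedge
  have hcyc : ∀ k < 2 * n + 1, M (blockRel fun i => k ≤ i ∧ i ≤ k + 1) := fun k hk => by
    obtain rfl | hk := Nat.eq_or_lt_of_le (Nat.le_of_lt_succ hk)
    · exact hM.block_last_two hn hβ hγ hends
    · exact hedge k hk
  have hc := hM.block_zero_last hn hβ hγ hends
  obtain h | h := Nat.lt_or_gt_of_ne hxy
  · exact hM.block_pair_of_cycle h0 hcyc hc h (by omega)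
  · exact hM.block_congr (hM.block_pair_of_cycle h0 hcyc hc h (by omega)) fun i _ => or_comm

theorem pair_right (hM : IsSublatticeBelow N M)
    (hB : ∀ x < N, ∀ y < N, x ≠ y → M (blockRel fun i => i = x ∨ i = y))
    {x y z : ℕ} (hx : x < N) (hy : y < N) (hz : z < N) (hxy : x ≠ y) (hxz : x ≠ z)
    (h : M (pairRel x y)) : M (pairRel x z) := by
  by_cases hyz : y = z
  · exact hyz ▸ h
  refine hM.join_meet (fun i j => i = j ∨ ((i = x ∨ i = y ∨ i = z) ∧ (j = y ∨ j = z)))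
    h (hB y hy z hz hyz) (hB x hx z hz hxz) ?_ ?_ ?_ ?_ ?_ ?_
  · constructor <;> omega
  · simp only [LeBelow, pairRel]; omega
  · simp only [LeBelow, blockRel]; omega
  · simp only [LeBelow, blockRel, pairRel]; omega
  · simp only [LeBelow, blockRel, pairRel]; omega
  · rintro q ⟨hr, ht⟩ h1 h2 i hi j hj (rfl | ⟨rfl, rfl⟩)
    · exact hr i hi
    · exact ht _ hi y hy _ hj (h1 _ hi _ hy (Or.inr ⟨rfl, rfl⟩))
        (h2 _ hy _ hj (Or.inr ⟨Or.inl rfl, Or.inr rfl⟩))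

theorem pair_left (hM : IsSublatticeBelow N M)
    (hB : ∀ x < N, ∀ y < N, x ≠ y → M (blockRel fun i => i = x ∨ i = y))
    {x y z : ℕ} (hx : x < N) (hy : y < N) (hz : z < N) (hxy : x ≠ y) (hzy : z ≠ y)
    (h : M (pairRel x y)) : M (pairRel z y) := by
  by_cases hxz : x = z
  · exact hxz ▸ h
  refine hM.join_meet (fun i j => i = j ∨ ((i = x ∨ i = z) ∧ (j = x ∨ j = y ∨ j = z)))
    h (hB x hx z hz hxz) (hB z hz y hy hzy) ?_ ?_ ?_ ?_ ?_ ?_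
  · constructor <;> omega
  · simp only [LeBelow, pairRel]; omega
  · simp only [LeBelow, blockRel]; omega
  · simp only [LeBelow, blockRel, pairRel]; omega
  · simp only [LeBelow, blockRel, pairRel]; omega
  · rintro q ⟨hr, ht⟩ h1 h2 i hi j hj (rfl | ⟨rfl, rfl⟩)
    · exact hr i hi
    · exact ht _ hi x hx _ hj (h2 _ hi _ hx (Or.inr ⟨Or.inr rfl, Or.inl rfl⟩))
        (h1 _ hx _ hj (Or.inr ⟨rfl, rfl⟩))

theorem pair_of_pair (hM : IsSublatticeBelow N M)
    (hB : ∀ x < N, ∀ y < N, x ≠ y → M (blockRel fun i => i = x ∨ i = y)) (hN : 3 ≤ N)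
    {u v x y : ℕ} (hu : u < N) (hv : v < N) (hx : x < N) (hy : y < N) (huv : u ≠ v)
    (hxy : x ≠ y) (h : M (pairRel u v)) : M (pairRel x y) := by
  by_cases hyu : y = u
  · obtain ⟨w, hw, hwu, hwx⟩ : ∃ w < N, w ≠ u ∧ w ≠ x := by
      by_cases h0 : 0 ≠ u ∧ 0 ≠ x
      · exact ⟨0, by omega, h0⟩
      by_cases h1 : 1 ≠ u ∧ 1 ≠ x
      · exact ⟨1, by omega, h1⟩
      · exact ⟨2, by omega, by omega, by omega⟩
    exact hM.pair_right hB hx hw hy hwx.symm hxy <|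
      hM.pair_left hB hu hw hx hwu.symm hwx.symm (hM.pair_right hB hu hv hw huv hwu.symm h)
  · exact hM.pair_left hB hu hy hx (Ne.symm hyu) hxy (hM.pair_right hB hu hv hy huv (Ne.symm hyu) h)

theorem pair_mem (hM : IsSublatticeBelow (2 * n + 2) M) (hn : 2 ≤ n)
    (hα : M (parityRel n)) (hβ : M evenMatching) (hγ : M (oddMatching n)) (hδ : M (endsRel n))
    {x y : ℕ} (hx : x < 2 * n + 2) (hy : y < 2 * n + 2) (hxy : x ≠ y) : M (pairRel x y) := by
  have hB : ∀ x < 2 * n + 2, ∀ y < 2 * n + 2, x ≠ y → M (blockRel fun i => i = x ∨ i = y) :=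
    fun x hx y hy hxy => hM.block_pair_mem hn hα hβ hγ hδ hx hy hxy
  have h : M (pairRel (2 * n + 1) 2) :=
    hM.meet hδ (hB (2 * n + 1) (by omega) 2 (by omega) (by omega)) fun i _ j _ => by
      simp only [pairRel, endsRel, blockRel]; omega
  exact hM.pair_of_pair hB (by omega) (by omega) (by omega) hx hy (by omega) hxy h

end IsSublatticeBelow

section Transport

variable {α : Type u}

theorem subset_quoGen (r : Set (α × α)) : r ⊆ quoGen r :=
  fun _ hp _ hs => hs.2 hp

theorem quoGen_subset {r s : Set (α × α)} (hs : IsQuoRel s) (h : r ⊆ s) : quoGen r ⊆ s :=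
  fun _ hp => hp s ⟨hs, h⟩

/-- The relation on `α` obtained from a relation on `ℕ` through a labelling `v : α → ℕ`. -/
def pullRel (v : α → ℕ) (P : ℕ → ℕ → Prop) : Set (α × α) := {p | P (v p.1) (v p.2)}

theorem pullRel_joinBelow {N : ℕ} {v : α → ℕ} {z : ℕ → α} (hv : ∀ a, v a < N)
    (hzv : ∀ a, z (v a) = a) (hvz : ∀ i < N, v (z i) = i) (P Q : ℕ → ℕ → Prop) :
    pullRel v (joinBelow N P Q) = quoGen (pullRel v P ∪ pullRel v Q) := by
  apply Set.Subset.antisymm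
  · rintro ⟨a, b⟩ h s ⟨hs, hPQ⟩
    have := h (fun i j => (z i, z j) ∈ s)
      ⟨fun i _ => hs.1 _, fun i _ j _ k _ => hs.2 _ _ _⟩
      (fun i hi j hj hP => hPQ (Or.inl (by simpa [pullRel, hvz i hi, hvz j hj] using hP)))
      (fun i hi j hj hQ => hPQ (Or.inr (by simpa [pullRel, hvz i hi, hvz j hj] using hQ)))
    simpa [hzv] using this
  · refine quoGen_subset ⟨fun a q hq _ _ => hq.1 _ (hv a), ?_⟩ ?_
    · exact fun a b c h1 h2 q hq hP hQ =>
        hq.2 _ (hv a) _ (hv b) _ (hv c) (h1 q hq hP hQ) (h2 q hq hP hQ)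
    · rintro ⟨a, b⟩ (h | h) q hq hP hQ
      · exact hP _ (hv a) _ (hv b) h
      · exact hQ _ (hv a) _ (hv b) h

theorem isSublatticeBelow_pullRel {N : ℕ} {v : α → ℕ} {z : ℕ → α} (hv : ∀ a, v a < N)
    (hzv : ∀ a, z (v a) = a) (hvz : ∀ i < N, v (z i) = i) {T : Set (Set (α × α))}
    (hsup : ∀ a ∈ T, ∀ b ∈ T, quoGen (a ∪ b) ∈ T) (hinf : ∀ a ∈ T, ∀ b ∈ T, a ∩ b ∈ T) :
    IsSublatticeBelow N fun P => pullRel v P ∈ T where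
  congr P Q hPQ hQP h := by
    have : pullRel v P = pullRel v Q :=
      Set.ext fun p => ⟨hPQ _ (hv _) _ (hv _), hQP _ (hv _) _ (hv _)⟩
    exact this ▸ h
  inf P Q hP hQ := hinf _ hP _ hQ
  sup P Q hP hQ := by
    rw [pullRel_joinBelow hv hzv hvz]
    exact hsup _ hP _ hQ

theorem isQuoRel_pullRel {N : ℕ} {v : α → ℕ} (hv : ∀ a, v a < N) {P : ℕ → ℕ → Prop}
    (hP : IsQuoBelow N P) : IsQuoRel (pullRel v P) :=
  ⟨fun a => hP.1 _ (hv a), fun a b c => hP.2 _ (hv a) _ (hv b) _ (hv c)⟩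

/-- On a finite set, a sublattice of `Quo(α)` containing the diagonal and all the atoms is
everything. -/
theorem mem_of_forall_atom_mem [Finite α] {T : Set (Set (α × α))}
    (hsup : ∀ a ∈ T, ∀ b ∈ T, quoGen (a ∪ b) ∈ T) (hdiag : diagRel α ∈ T)
    (hatom : ∀ a b : α, a ≠ b → {p : α × α | p.1 = p.2 ∨ p = (a, b)} ∈ T)
    {r : Set (α × α)} (hr : IsQuoRel r) : r ∈ T := by
  suffices h : ∀ s : Set (α × α), s.Finite → s ⊆ r → ∃ t ∈ T, s ⊆ t ∧ t ⊆ r by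
    obtain ⟨t, ht, h1, h2⟩ := h r (Set.toFinite r) Subset.rfl
    exact (h1.antisymm h2) ▸ ht
  intro s hs
  induction s, hs using Set.Finite.induction_on with
  | empty =>
    rintro -
    refine ⟨_, hdiag, Set.empty_subset _, ?_⟩
    rintro ⟨a, b⟩ (rfl : a = b)
    exact hr.1 a
  | @insert p s _ _ ih =>
    intro hps
    obtain ⟨t, ht, hst, htr⟩ := ih ((Set.subset_insert _ _).trans hps)
    obtain ⟨a, b⟩ := p
    have hab : (a, b) ∈ r := hps (Set.mem_insert _ _)
    have hA : {p : α × α | p.1 = p.2 ∨ p = (a, b)} ∈ T := by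
      by_cases h : a = b
      · have : {p : α × α | p.1 = p.2 ∨ p = (a, b)} = diagRel α := by
          ext ⟨x, y⟩
          simp only [diagRel, Set.mem_ofPred_eq, Prod.mk.injEq, or_iff_left_iff_imp]
          rintro ⟨rfl, rfl⟩
          exact h
        exact this ▸ hdiag
      · exact hatom a b h
    refine ⟨_, hsup _ hA _ ht, ?_, quoGen_subset hr ?_⟩
    · refine Set.insert_subset (subset_quoGen _ (Or.inl (Or.inr rfl))) ?_
      exact hst.trans (Set.subset_union_right.trans (subset_quoGen _))
    · refine Set.union_subset ?_ htr
      rintro ⟨x, y⟩ ((rfl : x = y) | h)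
      · exact hr.1 x
      · exact h ▸ hab

end Transport

/-- If `A` is finite with `|A| ≥ 6` even, then the lattice `Quo(A)` is four-generated. -/
theorem quo_four_generated_finite_even {α : Type u} [Finite α]
    (h6 : 6 ≤ Nat.card α) (heven : Even (Nat.card α)) :
    ∃ x₁ x₂ x₃ x₄ : Set (α × α), QuoLatGenerates {x₁, x₂, x₃, x₄} := by
  obtain ⟨m, hm⟩ := heven
  obtain ⟨n, rfl⟩ : ∃ n, m = n + 1 := ⟨m - 1, by omega⟩
  have hn : 2 ≤ n := by omega
  have hcard : Nat.card α = 2 * n + 2 := by omega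
  let e : α ≃ Fin (2 * n + 2) := Finite.equivFinOfCardEq hcard
  let v : α → ℕ := fun a => (e a).val
  let z : ℕ → α := fun i => e.symm (Fin.ofNat (2 * n + 2) i)
  have hv : ∀ a, v a < 2 * n + 2 := fun a => (e a).isLt
  have hzv : ∀ a, z (v a) = a := fun a => by
    simp [z, v]
  have hvz : ∀ i < 2 * n + 2, v (z i) = i := fun i hi => by
    simp [z, v, Nat.mod_eq_of_lt hi]
  have hinj : ∀ a b, v a = v b ↔ a = b := fun a b =>
    ⟨fun h => by rw [← hzv a, h, hzv b], fun h => h ▸ rfl⟩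
  refine ⟨pullRel v (parityRel n), pullRel v evenMatching, pullRel v (oddMatching n),
    pullRel v (endsRel n), ?_, fun T hT hX hsup hinf => hT.antisymm fun r hr => ?_⟩
  · rintro r (rfl | rfl | rfl | rfl) <;> refine isQuoRel_pullRel hv ⟨?_, ?_⟩
    · simp [parityRel]
    · simp only [parityRel]; omega
    · simp [evenMatching]
    · simp only [evenMatching]; omega
    · simp [oddMatching]
    · simp only [oddMatching]; omega
    · simp [endsRel]
    · simp only [endsRel]; omega
  · have hM := isSublatticeBelow_pullRel hv hzv hvz hsup hinf
    have hα : pullRel v (parityRel n) ∈ T := hX (by simp)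
    have hβ : pullRel v evenMatching ∈ T := hX (by simp)
    have hγ : pullRel v (oddMatching n) ∈ T := hX (by simp)
    have hδ : pullRel v (endsRel n) ∈ T := hX (by simp)
    refine mem_of_forall_atom_mem hsup ?_ (fun a b hab => ?_) hr
    · have h : pullRel v Eq ∈ T :=
        hM.meet hα hβ fun i _ j _ => by simp only [parityRel, evenMatching]; omega
      have heq : pullRel v Eq = diagRel α := by
        ext ⟨x, y⟩
        simp [pullRel, diagRel, hinj]
      exact heq ▸ h
    · have h : pullRel v (pairRel (v a) (v b)) ∈ T :=
        hM.pair_mem hn hα hβ hγ hδ (hv a) (hv b) (fun h => hab ((hinj a b).1 h))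
      have heq : pullRel v (pairRel (v a) (v b)) = {p : α × α | p.1 = p.2 ∨ p = (a, b)} := by
        ext ⟨x, y⟩
        simp [pullRel, pairRel, hinj]
      exact heq ▸ h
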